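/- arXiv:2510.23951 — 11 statements merged into one kernel-verified Lean document; each statement's English description precedes it below -/
import Mathlib

section
/- Let p ∈ (0,1) and let G be a real number with G > κ. Then for every pair (α, β) ∈ F(G) one has p·α + (1−p)·β ≤ 1 − (2·√(p·(1−p)·G) − 1)/(G − 1). -/
open Real Filter

noncomputable def kap (p : ℝ) : ℝ := max (p / (1 - p)) ((1 - p) / p)

/-- The feasible set of the relaxed receiver problem (RR). -/
def Feas (G : ℝ) : Set (ℝ × ℝ) :=
  {ab | 0 ≤ ab.1 ∧ ab.1 ≤ 1 ∧ 0 ≤ ab.2 ∧ ab.2 ≤ 1 ∧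
    ab.1 * ab.2 ≤ G * (1 - ab.1) * (1 - ab.2)}

noncomputable def astar (p G : ℝ) : ℝ := (G - Real.sqrt ((1 - p) * G / p)) / (G - 1)

noncomputable def bstar (p G : ℝ) : ℝ := (G - Real.sqrt (p * G / (1 - p))) / (G - 1)

noncomputable def Vval (p G : ℝ) : ℝ := 1 - (2 * Real.sqrt (p * (1 - p) * G) - 1) / (G - 1)

theorem stmt_0 (p G : ℝ) (hp0 : 0 < p) (hp1 : p < 1) (hG : G > kap p) :
    ∀ α β : ℝ, (α, β) ∈ Feas G →
      p * α + (1 - p) * β ≤ 1 - (2 * Real.sqrt (p * (1 - p) * G) - 1) / (G - 1) := by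
  rintro α β ⟨-, hα, -, hβ, h⟩
  dsimp only at hα hβ h
  have hq : 0 < 1 - p := sub_pos.mpr hp1
  have hG1 : 1 < G := by
    rcases max_lt_iff.mp hG with ⟨h₁, h₂⟩
    rw [div_lt_iff₀ hq] at h₁
    rw [div_lt_iff₀ hp0] at h₂
    linarith
  have hg : 0 < G - 1 := sub_pos.mpr hG1
  have hA : 0 ≤ (G - 1) * (1 - α) := mul_nonneg hg.le (sub_nonneg.mpr hα)
  have hB : 0 ≤ (G - 1) * (1 - β) := mul_nonneg hg.le (sub_nonneg.mpr hβ)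
  have hAB : G ≤ ((G - 1) * (1 - α) + 1) * ((G - 1) * (1 - β) + 1) := by
    nlinarith [mul_le_mul_of_nonneg_left h hg.le]
  have hsqrt : 2 * √(p * (1 - p) * G) ≤
      p * ((G - 1) * (1 - α) + 1) + (1 - p) * ((G - 1) * (1 - β) + 1) := by
    generalize (G - 1) * (1 - α) = A at *
    generalize (G - 1) * (1 - β) = B at *
    have key : √(p * (1 - p) * G) ≤ (p * (A + 1) + (1 - p) * (B + 1)) / 2 := by
      apply Real.sqrt_le_iff.mpr
      refine ⟨by positivity, ?_⟩
      nlinarith [mul_le_mul_of_nonneg_left hAB (mul_pos hp0 hq).le,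
        sq_nonneg (p * (A + 1) - (1 - p) * (B + 1))]
    linarith
  have hdiv : (2 * √(p * (1 - p) * G) - 1) / (G - 1) ≤ p * (1 - α) + (1 - p) * (1 - β) := by
    rw [div_le_iff₀ hg]
    linarith
  linarith
end

section
/- Let p ∈ (0,1) and let G be a real number with G > κ. Then 0 < α*(G) < 1 and 0 < β*(G) < 1, the pair (α*(G), β*(G)) lies in F(G) and satisfies the constraint with equality, i.e. α*(G)·β*(G) = G·(1−α*(G))·(1−β*(G)), and p·α*(G) + (1−p)·β*(G) = 1 − (2·√(p·(1−p)·G) − 1)/(G − 1). -/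
open Real Filter

/-- If `k` and `k⁻¹` are both below `G`, then `√(k * G)` lies strictly between `1` and `G`. -/
lemma sqrt_mul_mem_Ioo {k G : ℝ} (hk : 0 < k) (hkG : k < G) (hinv : k⁻¹ < G) :
    √(k * G) ∈ Set.Ioo 1 G := by
  have hG : 0 < G := hk.trans hkG
  refine ⟨Real.lt_sqrt_of_sq_lt ?_, (Real.sqrt_lt' hG).2 ?_⟩
  · rw [one_pow]
    exact (inv_lt_iff_one_lt_mul₀' hk).1 hinv
  · rw [sq]
    exact mul_lt_mul_of_pos_right hkG hG

lemma sub_div_sub_one_mem_Ioo {x G : ℝ} (hx : x ∈ Set.Ioo 1 G) :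
    (G - x) / (G - 1) ∈ Set.Ioo 0 1 := by
  obtain ⟨h1, h2⟩ := hx
  have hG : 0 < G - 1 := by linarith
  exact ⟨div_pos (by linarith) hG, (div_lt_one hG).2 (by linarith)⟩

lemma sub_div_mul_sub_div_eq {x y G : ℝ} (hG : G ≠ 1) (hxy : x * y = G) :
    (G - x) / (G - 1) * ((G - y) / (G - 1)) =
      G * (1 - (G - x) / (G - 1)) * (1 - (G - y) / (G - 1)) := by
  have hG' : G - 1 ≠ 0 := sub_ne_zero.2 hG
  field_simp
  linear_combination (1 - G) * hxy

theorem stmt_1 (p G : ℝ) (hp0 : 0 < p) (hp1 : p < 1) (hG : G > kap p) :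
    (0 < astar p G ∧ astar p G < 1) ∧
    (0 < bstar p G ∧ bstar p G < 1) ∧
    (astar p G, bstar p G) ∈ Feas G ∧
    astar p G * bstar p G = G * (1 - astar p G) * (1 - bstar p G) ∧
    p * astar p G + (1 - p) * bstar p G
      = 1 - (2 * Real.sqrt (p * (1 - p) * G) - 1) / (G - 1) := by
  have hq : 0 < 1 - p := sub_pos.2 hp1
  obtain ⟨h1, h2⟩ := max_lt_iff.1 (show max (p / (1 - p)) ((1 - p) / p) < G from hG)
  have hx : √((1 - p) * G / p) ∈ Set.Ioo 1 G := by
    rw [mul_div_right_comm]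
    exact sqrt_mul_mem_Ioo (div_pos hq hp0) h2 (by rwa [inv_div])
  have hy : √(p * G / (1 - p)) ∈ Set.Ioo 1 G := by
    rw [mul_div_right_comm]
    exact sqrt_mul_mem_Ioo (div_pos hp0 hq) h1 (by rwa [inv_div])
  have hG1 : 1 < G := hx.1.trans hx.2
  have hG0 : 0 < G := one_pos.trans hG1
  have hxy : √((1 - p) * G / p) * √(p * G / (1 - p)) = G := by
    rw [← Real.sqrt_mul (by positivity), Real.sqrt_eq_iff_mul_self_eq (by positivity) hG0.le]
    field_simp
  have hpx : p * √((1 - p) * G / p) = √(p * (1 - p) * G) := by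
    rw [show p * (1 - p) * G = p ^ 2 * ((1 - p) * G / p) by field_simp,
      Real.sqrt_mul (sq_nonneg p), Real.sqrt_sq hp0.le]
  have hqy : (1 - p) * √(p * G / (1 - p)) = √(p * (1 - p) * G) := by
    rw [show p * (1 - p) * G = (1 - p) ^ 2 * (p * G / (1 - p)) by field_simp,
      Real.sqrt_mul (sq_nonneg (1 - p)), Real.sqrt_sq hq.le]
  have ha : astar p G ∈ Set.Ioo 0 1 := sub_div_sub_one_mem_Ioo hx
  have hb : bstar p G ∈ Set.Ioo 0 1 := sub_div_sub_one_mem_Ioo hy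
  have hab : astar p G * bstar p G = G * (1 - astar p G) * (1 - bstar p G) :=
    sub_div_mul_sub_div_eq hG1.ne' hxy
  refine ⟨ha, hb, ⟨ha.1.le, ha.2.le, hb.1.le, hb.2.le, hab.le⟩, hab, ?_⟩
  have hG' : G - 1 ≠ 0 := (sub_pos.2 hG1).ne'
  unfold astar bstar
  rw [mul_div_assoc', mul_div_assoc', ← add_div, one_sub_div hG']
  congr 1
  linear_combination -hpx - hqy
end

section
/- Let p ∈ (0,1) and let G be a real number with G ≥ 1. If (α, β) ∈ F(G) attains the supremum of J_p over F(G), i.e. p·α + (1−p)·β = sSup { p·α' + (1−p)·β' : (α', β') ∈ F(G) }, then the constraint binds: α·β = G·(1−α)·(1−β). -/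
open Real Filter

theorem stmt_2 (p G : ℝ) (hp0 : 0 < p) (hp1 : p < 1) (hG : 1 ≤ G)
    (α β : ℝ) (hfeas : (α, β) ∈ Feas G)
    (hopt : p * α + (1 - p) * β
      = sSup {x : ℝ | ∃ a b : ℝ, (a, b) ∈ Feas G ∧ x = p * a + (1 - p) * b}) :
    α * β = G * (1 - α) * (1 - β) := by
  obtain ⟨hα0, hα1, hβ0, hβ1, hle⟩ := hfeas
  simp only at hα0 hα1 hβ0 hβ1 hle
  refine hle.eq_of_not_lt fun hlt => ?_
  have hD : 0 < β + G * (1 - β) := by nlinarith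
  -- Holding `β` fixed, this is the value of the first coordinate at which the constraint binds.
  set a : ℝ := G * (1 - β) / (β + G * (1 - β)) with ha
  have haD : a * (β + G * (1 - β)) = G * (1 - β) := div_mul_cancel₀ _ hD.ne'
  have hαa : α < a := by
    rw [ha, lt_div_iff₀ hD]
    linarith
  have ha1 : a ≤ 1 := by
    rw [ha, div_le_one hD]
    linarith
  have hfeas' : (a, β) ∈ Feas G :=
    ⟨hα0.trans hαa.le, ha1, hβ0, hβ1, by simp only; linarith⟩
  have hbdd : BddAbove {x : ℝ | ∃ a b : ℝ, (a, b) ∈ Feas G ∧ x = p * a + (1 - p) * b} := by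
    refine ⟨1, ?_⟩
    rintro x ⟨c, d, ⟨-, hc, -, hd, -⟩, rfl⟩
    simp only at hc hd
    nlinarith
  have hmax := le_csSup hbdd ⟨a, β, hfeas', rfl⟩
  rw [← hopt] at hmax
  linarith [mul_lt_mul_of_pos_left hαa hp0]
end

section
/- Let p ∈ (0,1) and let G be a real number with G > κ. Then V(G) = 1 − (2·√(p·(1−p)·G) − 1)/(G − 1) is the greatest value of J_p on F(G): every (α, β) ∈ F(G) satisfies p·α + (1−p)·β ≤ V(G), and the pair (α*(G), β*(G)) lies in F(G) and satisfies p·α*(G) + (1−p)·β*(G) = V(G). -/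
open Real Filter

/-- Weighted AM-GM in the form used for the upper bound. -/
theorem two_mul_sqrt_le_of_le_mul {p q G u v : ℝ} (hp : 0 ≤ p) (hq : 0 ≤ q) (hu : 0 ≤ u)
    (hv : 0 ≤ v) (h : G ≤ u * v) : 2 * Real.sqrt (p * q * G) ≤ p * u + q * v := by
  have hS : Real.sqrt (p * q * G) ≤ (p * u + q * v) / 2 := by
    apply Real.sqrt_le_iff.mpr
    refine ⟨by positivity, ?_⟩
    have := mul_le_mul_of_nonneg_left h (mul_nonneg hp hq)
    nlinarith [sq_nonneg (p * u - q * v)]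
  linarith

theorem sqrt_mul_div_eq {p q G : ℝ} (hp : 0 < p) :
    Real.sqrt (q * G / p) = Real.sqrt (p * q * G) / p := by
  rw [show q * G / p = p * q * G / p ^ 2 by field_simp, Real.sqrt_div' _ (sq_nonneg p),
    Real.sqrt_sq hp.le]

theorem stmt_3 (p G : ℝ) (hp0 : 0 < p) (hp1 : p < 1) (hG : G > kap p) :
    (∀ α β : ℝ, (α, β) ∈ Feas G → p * α + (1 - p) * β ≤ Vval p G) ∧
    (astar p G, bstar p G) ∈ Feas G ∧
    p * astar p G + (1 - p) * bstar p G = Vval p G := by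
  have hq : 0 < 1 - p := sub_pos.mpr hp1
  obtain ⟨h₁, h₂⟩ := max_lt_iff.mp hG
  rw [div_lt_iff₀ hq] at h₁
  rw [div_lt_iff₀ hp0] at h₂
  have hG1 : 1 < G := by linarith
  have hd : 0 < G - 1 := sub_pos.mpr hG1
  have hpG : p ≤ Real.sqrt (p * (1 - p) * G) := Real.le_sqrt_of_sq_le (by nlinarith)
  have hqG : 1 - p ≤ Real.sqrt (p * (1 - p) * G) := Real.le_sqrt_of_sq_le (by nlinarith)
  have hSp : Real.sqrt (p * (1 - p) * G) ≤ G * p :=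
    Real.sqrt_le_iff.mpr ⟨by positivity, by nlinarith [mul_pos hp0 (zero_lt_one.trans hG1)]⟩
  have hSq : Real.sqrt (p * (1 - p) * G) ≤ G * (1 - p) :=
    Real.sqrt_le_iff.mpr ⟨by positivity, by nlinarith [mul_pos hq (zero_lt_one.trans hG1)]⟩
  have hS2 : Real.sqrt (p * (1 - p) * G) ^ 2 = p * (1 - p) * G := Real.sq_sqrt (by positivity)
  have ha : astar p G = (G - Real.sqrt (p * (1 - p) * G) / p) / (G - 1) := by
    rw [astar, sqrt_mul_div_eq hp0]
  have hb : bstar p G = (G - Real.sqrt (p * (1 - p) * G) / (1 - p)) / (G - 1) := by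
    rw [bstar, sqrt_mul_div_eq hq, mul_comm (1 - p) p]
  refine ⟨?_, ?_, ?_⟩
  · rintro α β ⟨-, hα, -, hβ, h⟩
    dsimp only at hα hβ h
    have hu : 0 ≤ (G - 1) * (1 - α) + 1 := by
      have := mul_nonneg hd.le (sub_nonneg.mpr hα)
      linarith
    have hv : 0 ≤ (G - 1) * (1 - β) + 1 := by
      have := mul_nonneg hd.le (sub_nonneg.mpr hβ)
      linarith
    have key := two_mul_sqrt_le_of_le_mul hp0.le hq.le hu hv (G := G) (by nlinarith)
    rw [Vval, le_sub_comm, div_le_iff₀ hd]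
    linarith
  · rw [ha, hb]
    generalize Real.sqrt (p * (1 - p) * G) = S at *
    refine ⟨?_, ?_, ?_, ?_, le_of_eq ?_⟩
    · exact div_nonneg (sub_nonneg.mpr ((div_le_iff₀ hp0).mpr hSp)) hd.le
    · rw [div_le_one hd]
      linarith [(one_le_div hp0).mpr hpG]
    · exact div_nonneg (sub_nonneg.mpr ((div_le_iff₀ hq).mpr hSq)) hd.le
    · rw [div_le_one hd]
      linarith [(one_le_div hq).mpr hqG]
    · have hd' := hd.ne'
      have hq' := hq.ne'
      field_simp
      linear_combination (1 - G) * hS2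
  · rw [ha, hb, Vval]
    have hd' := hd.ne'
    have hq' := hq.ne'
    field_simp
    ring
end

section
/- Let p ∈ (0,1) and let G be a real number with G > κ. If (α, β) ∈ F(G) satisfies p·α + (1−p)·β = V(G), then α = α*(G) and β = β*(G); that is, the optimal solution of the relaxed problem is unique. -/
open Real Filter

theorem one_lt_of_kap_lt {p G : ℝ} (hp0 : 0 < p) (hp1 : p < 1) (hG : kap p < G) : 1 < G := by
  have hq : 0 < 1 - p := sub_pos.mpr hp1
  refine lt_of_le_of_lt ?_ hG
  rcases le_total (1 - p) p with h | h
  · exact le_max_of_le_left ((one_le_div hq).mpr h)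
  · exact le_max_of_le_right ((one_le_div hp0).mpr h)

theorem sqrt_mul_div_eq_s5 {a b G : ℝ} (ha : 0 < a) :
    √(b * G / a) = √(a * b * G) / a := by
  have h : b * G / a = a * b * G / a ^ 2 := by field_simp
  rw [h, Real.sqrt_div' _ (sq_nonneg a), Real.sqrt_sq ha.le]

theorem stmt_5 (p G : ℝ) (hp0 : 0 < p) (hp1 : p < 1) (hG : G > kap p)
    (α β : ℝ) (hfeas : (α, β) ∈ Feas G)
    (hval : p * α + (1 - p) * β = Vval p G) :
    α = astar p G ∧ β = bstar p G := by
  obtain ⟨-, -, -, -, hc⟩ := hfeas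
  dsimp only at hc
  have hG1 : 0 < G - 1 := sub_pos.mpr (one_lt_of_kap_lt hp0 hp1 hG)
  have hq : 0 < 1 - p := sub_pos.mpr hp1
  have hpq : 0 < p * (1 - p) := mul_pos hp0 hq
  have hs2 : √(p * (1 - p) * G) ^ 2 = p * (1 - p) * G :=
    Real.sq_sqrt (mul_pos hpq (by linarith)).le
  unfold Vval at hval
  unfold astar bstar
  rw [sqrt_mul_div_eq_s5 hp0, sqrt_mul_div_eq_s5 hq, mul_comm (1 - p) p]
  set s := √(p * (1 - p) * G)
  obtain ⟨x, hx⟩ : ∃ x, x = G - (G - 1) * α := ⟨_, rfl⟩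
  obtain ⟨y, hy⟩ : ∃ y, y = G - (G - 1) * β := ⟨_, rfl⟩
  have hsum : p * x + (1 - p) * y = 2 * s := by
    field_simp at hval
    rw [hx, hy]
    linear_combination -hval
  have hxy : G ≤ x * y := by
    have := mul_nonneg hG1.le (sub_nonneg.mpr hc)
    rw [hx, hy]
    linarith
  have hdiff : p * x - (1 - p) * y = 0 := by
    have h : (p * x - (1 - p) * y) ^ 2 = 4 * (p * (1 - p) * (G - x * y)) := by
      linear_combination (p * x + (1 - p) * y + 2 * s) * hsum + 4 * hs2
    have h' := mul_nonneg hpq.le (sub_nonneg.mpr hxy)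
    exact pow_eq_zero_iff two_ne_zero |>.mp (le_antisymm (by linarith) (sq_nonneg _))
  have hxs : s / p = x := by
    rw [div_eq_iff hp0.ne']
    linarith
  have hys : s / (1 - p) = y := by
    rw [div_eq_iff hq.ne']
    linarith
  rw [hxs, hys, eq_div_iff hG1.ne', eq_div_iff hG1.ne', hx, hy]
  constructor <;> ring
end

section
/- Let p ∈ (0,1) with p ≠ 1/2, and let G be a real number with 1 ≤ G ≤ κ. If (α, β) ∈ F(G) satisfies p·α + (1−p)·β = max(p, 1−p), then (α, β) = (1, 0) when p > 1/2 and (α, β) = (0, 1) when p < 1/2. -/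
open Real Filter

/-- The vertex `(1, 0)` is the only point of `Feas G` with objective value `p` when the weight `p`
dominates the weight `q` and `G` is at most their ratio. -/
lemma eq_vertex_of_objective_eq {p q G α β : ℝ} (hq : 0 < q) (hqp : q < p) (hG1 : 1 ≤ G)
    (hG : G ≤ p / q) (hα : α ≤ 1) (hαβ : α * β ≤ G * (1 - α) * (1 - β))
    (hval : p * α + q * β = p) : α = 1 ∧ β = 0 := by
  have hGq : G * q ≤ p := (le_div_iff₀ hq).1 hG
  have hβ : q * β = p * (1 - α) := by linarith
  have hα1 : α = 1 := by
    by_contra hne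
    have hu : 0 < 1 - α := sub_pos.2 (lt_of_le_of_ne hα hne)
    have hscaled : (1 - α) * (p * α) ≤ (1 - α) * (G * (q - p * (1 - α))) := by
      have hmul := mul_le_mul_of_nonneg_left hαβ hq.le
      linear_combination hmul - (α + G * (1 - α)) * hβ
    have hcancel := le_of_mul_le_mul_left hscaled hu
    have hpu : 0 < p * (1 - α) := mul_pos (hq.trans hqp) hu
    have hG_le : G ≤ 1 := by
      by_contra! hlt
      nlinarith [mul_pos hpu (sub_pos.2 hlt)]
    obtain rfl : G = 1 := le_antisymm hG_le hG1
    linarith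
  refine ⟨hα1, ?_⟩
  rw [hα1, sub_self, mul_zero] at hβ
  exact (mul_eq_zero.1 hβ).resolve_left hq.ne'

theorem stmt_6 (p G : ℝ) (hp0 : 0 < p) (hp1 : p < 1) (hp : p ≠ 1 / 2)
    (hG1 : 1 ≤ G) (hGk : G ≤ kap p)
    (α β : ℝ) (hfeas : (α, β) ∈ Feas G)
    (hval : p * α + (1 - p) * β = max p (1 - p)) :
    (p > 1 / 2 → (α, β) = ((1 : ℝ), (0 : ℝ))) ∧
    (p < 1 / 2 → (α, β) = ((0 : ℝ), (1 : ℝ))) := by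
  obtain ⟨-, hα1, -, hβ1, hαβ⟩ := hfeas
  dsimp only at hα1 hβ1 hαβ
  have hq0 : 0 < 1 - p := sub_pos.2 hp1
  constructor
  · intro h
    have hqp : 1 - p < p := by linarith
    have hkap : kap p = p / (1 - p) :=
      max_eq_left (div_le_div₀ hp0.le hqp.le hq0 hqp.le)
    obtain ⟨rfl, rfl⟩ := eq_vertex_of_objective_eq hq0 hqp hG1 (hkap ▸ hGk) hα1 hαβ
      (hval.trans (max_eq_left hqp.le))
    rfl
  · intro h
    have hpq : p < 1 - p := by linarith
    have hkap : kap p = (1 - p) / p :=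
      max_eq_right (div_le_div₀ hq0.le hpq.le hp0 hpq.le)
    rw [max_eq_right hpq.le, add_comm] at hval
    obtain ⟨rfl, rfl⟩ := eq_vertex_of_objective_eq hp0 hpq hG1 (hkap ▸ hGk) hβ1
      (by linarith) hval
    rfl
end

section
/- Let p ∈ (0,1) and let G be a real number with G > κ. Then 1 − (2·√(p·(1−p)·G) − 1)/(G − 1) > max(p, 1−p). -/
open Real Filter

/-- Strict arithmetic-geometric mean inequality for `a` and `b`, with `b < a`. -/
theorem two_mul_sqrt_mul_lt_add {a b : ℝ} (hb : 0 < b) (hab : b < a) :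
    2 * Real.sqrt (a * b) < a + b := by
  have h : Real.sqrt (a * b) < (a + b) / 2 := by
    rw [Real.sqrt_lt' (by linarith)]
    nlinarith [sq_pos_of_pos (sub_pos.mpr hab)]
  linarith

theorem stmt_7 (p G : ℝ) (hp0 : 0 < p) (hp1 : p < 1) (hG : G > kap p) :
    1 - (2 * Real.sqrt (p * (1 - p) * G) - 1) / (G - 1) > max p (1 - p) := by
  obtain ⟨h₁, h₂⟩ := max_lt_iff.mp hG
  have hq : 0 < 1 - p := sub_pos.mpr hp1
  rw [div_lt_iff₀ hq] at h₁
  rw [div_lt_iff₀ hp0] at h₂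
  have hG1 : 0 < G - 1 := by nlinarith
  have k₁ := two_mul_sqrt_mul_lt_add hp0 h₁
  have k₂ := two_mul_sqrt_mul_lt_add hq h₂
  rw [show G * (1 - p) * p = p * (1 - p) * G by ring] at k₁
  rw [show G * p * (1 - p) = p * (1 - p) * G by ring] at k₂
  refine max_lt ?_ ?_
  · rw [lt_sub_comm, div_lt_iff₀ hG1]
    linarith
  · rw [lt_sub_comm, div_lt_iff₀ hG1]
    linarith
end

section
/- Let p ∈ (0,1). The function V(G) = 1 − (2·√(p·(1−p)·G) − 1)/(G − 1) is strictly increasing on the interval (κ, ∞): for all reals G₁, G₂ with κ < G₁ < G₂ one has V(G₁) < V(G₂). -/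
open Real Filter

/-- The algebraic core of the monotonicity, with `a = √p`, `b = √(1 - p)`, `x = √G₁`, `y = √G₂`. -/
theorem quotient_lt_quotient {a b x y : ℝ} (hab : a ^ 2 + b ^ 2 = 1)
    (hx : 1 < x ^ 2) (hy : 1 < y ^ 2) (hxy : x < y) (hax : b < a * x) (hbx : a < b * x)
    (hay : b < a * y) (hby : a < b * y) :
    (2 * (a * b * y) - 1) / (y ^ 2 - 1) < (2 * (a * b * x) - 1) / (x ^ 2 - 1) := by
  rw [div_lt_div_iff₀ (by linarith) (by linarith)]
  have key : 0 < (y - x) * ((a * x - b) * (b * y - a) + (b * x - a) * (a * y - b)) :=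
    mul_pos (by linarith) (add_pos (mul_pos (by linarith) (by linarith))
      (mul_pos (by linarith) (by linarith)))
  linear_combination key - (y ^ 2 - x ^ 2) * hab

theorem bounds_of_kap_lt {p G : ℝ} (hp0 : 0 < p) (hp1 : p < 1) (hG : kap p < G) :
    1 < G ∧ √(1 - p) < √p * √G ∧ √p < √(1 - p) * √G := by
  have hq : 0 < 1 - p := by linarith
  obtain ⟨h₁, h₂⟩ := max_lt_iff.mp hG
  rw [div_lt_iff₀ hq] at h₁
  rw [div_lt_iff₀ hp0] at h₂
  refine ⟨by linarith, ?_, ?_⟩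
  · rw [← Real.sqrt_mul hp0.le]
    exact Real.sqrt_lt_sqrt hq.le (by linarith)
  · rw [← Real.sqrt_mul hq.le]
    exact Real.sqrt_lt_sqrt hp0.le (by linarith)

theorem stmt_8 (p : ℝ) (hp0 : 0 < p) (hp1 : p < 1) :
    ∀ G₁ G₂ : ℝ, kap p < G₁ → G₁ < G₂ → Vval p G₁ < Vval p G₂ := by
  intro G₁ G₂ h₁ h₂
  have hq : 0 ≤ 1 - p := by linarith
  obtain ⟨hG₁, hax, hbx⟩ := bounds_of_kap_lt hp0 hp1 h₁
  obtain ⟨hG₂, hay, hby⟩ := bounds_of_kap_lt hp0 hp1 (h₁.trans h₂)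
  have hs₁ : √G₁ ^ 2 = G₁ := Real.sq_sqrt (by linarith)
  have hs₂ : √G₂ ^ 2 = G₂ := Real.sq_sqrt (by linarith)
  have hab : √p ^ 2 + √(1 - p) ^ 2 = 1 := by
    rw [Real.sq_sqrt hp0.le, Real.sq_sqrt hq]
    ring
  have h := quotient_lt_quotient hab (by rwa [hs₁]) (by rwa [hs₂])
    (Real.sqrt_lt_sqrt (by linarith) h₂) hax hbx hay hby
  rw [hs₁, hs₂] at h
  unfold Vval
  rw [Real.sqrt_mul (mul_nonneg hp0.le hq), Real.sqrt_mul (mul_nonneg hp0.le hq),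
    Real.sqrt_mul hp0.le]
  linarith
end

section
/- Let p ∈ (0,1) and let G be a real number with G > κ. Suppose (α_n, β_n) is a sequence of pairs in F(G) such that p·α_n + (1−p)·β_n → V(G) as n → ∞. Then p·α_n + (1−p)·(1 − β_n) → p + (2p − 1)/(G − 1) as n → ∞. -/
open Real Filter

theorem one_le_kap {p : ℝ} (hp0 : 0 < p) (hp1 : p < 1) : 1 ≤ kap p := by
  have hq : 0 < 1 - p := sub_pos.2 hp1
  rcases le_total (1 - p) p with h | h
  · exact le_max_of_le_left ((one_le_div hq).2 h)
  · exact le_max_of_le_right ((one_le_div hp0).2 h)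

/-- In the coordinates `G - (G - 1) * a`, `G - (G - 1) * b`, the feasibility constraint is a
lower bound on a product. -/
theorem le_mul_of_mem_Feas {G a b : ℝ} (hG : 1 ≤ G) (h : (a, b) ∈ Feas G) :
    G ≤ (G - (G - 1) * a) * (G - (G - 1) * b) := by
  obtain ⟨-, -, -, -, h⟩ := h
  linear_combination mul_le_mul_of_nonneg_left h (sub_nonneg.2 hG)

/-- Equality case of the inequality between arithmetic and geometric means, in the limit. -/
theorem tendsto_sub_zero_of_sq_le_mul {ι : Type*} {l : Filter ι} {x y : ι → ℝ} {s : ℝ}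
    (hxy : ∀ i, s ^ 2 ≤ x i * y i) (h : Tendsto (fun i => x i + y i) l (nhds (2 * s))) :
    Tendsto (fun i => x i - y i) l (nhds 0) := by
  have hupper : Tendsto (fun i => (x i + y i) ^ 2 - 4 * s ^ 2) l (nhds 0) := by
    convert (h.pow 2).sub_const (4 * s ^ 2) using 2
    ring
  have hsq : Tendsto (fun i => (x i - y i) ^ 2) l (nhds 0) :=
    squeeze_zero (fun i => sq_nonneg _) (fun i => by linear_combination 4 * hxy i) hupper
  have habs := hsq.sqrt
  simp only [Real.sqrt_sq_eq_abs, Real.sqrt_zero] at habs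
  exact (tendsto_zero_iff_abs_tendsto_zero _).2 habs

theorem stmt_12 (p G : ℝ) (hp0 : 0 < p) (hp1 : p < 1) (hG : G > kap p)
    (α β : ℕ → ℝ) (hfeas : ∀ n, (α n, β n) ∈ Feas G)
    (hconv : Filter.Tendsto (fun n => p * α n + (1 - p) * β n)
      Filter.atTop (nhds (Vval p G))) :
    Filter.Tendsto (fun n => p * α n + (1 - p) * (1 - β n))
      Filter.atTop (nhds (p + (2 * p - 1) / (G - 1))) := by
  have hG1 : 1 < G := (one_le_kap hp0 hp1).trans_lt hG
  have hG0 : G - 1 ≠ 0 := (sub_pos.2 hG1).ne'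
  have hpq : 0 ≤ p * (1 - p) := mul_nonneg hp0.le (sub_nonneg.2 hp1.le)
  have hdiff : Tendsto
      (fun n => p * (G - (G - 1) * α n) - (1 - p) * (G - (G - 1) * β n)) atTop (nhds 0) := by
    apply tendsto_sub_zero_of_sq_le_mul (s := √(p * (1 - p) * G))
    · intro n
      rw [Real.sq_sqrt (mul_nonneg hpq (zero_le_one.trans hG1.le))]
      linear_combination mul_le_mul_of_nonneg_left (le_mul_of_mem_Feas hG1.le (hfeas n)) hpq
    · convert (hconv.const_mul (G - 1)).const_sub G using 2
      · ring
      · rw [Vval]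
        field_simp
        ring
  convert ((hdiff.div_const (G - 1)).const_sub (1 - p + (2 * p - 1) * G / (G - 1))) using 2
  · field_simp
    ring
  · field_simp
    ring
end

section
/- Let q be a real number with 1/2 < q < 1 and let n ≥ 1 be a natural number. Set G = (q/(1−q))^{2n}. Then q^n/(q^n + (1−q)^n) is the greatest value of the function (α, β) ↦ (α + β)/2 over the set of pairs (α, β) of reals with 0 ≤ α ≤ 1, 0 ≤ β ≤ 1, and α·β ≤ G·(1−α)·(1−β). -/
open Real Filter

theorem stmt_16 (q : ℝ) (hq : 1 / 2 < q) (hq1 : q < 1) (n : ℕ) (hn : 1 ≤ n) :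
    IsGreatest
      {x : ℝ | ∃ α β : ℝ, 0 ≤ α ∧ α ≤ 1 ∧ 0 ≤ β ∧ β ≤ 1 ∧
        α * β ≤ (q / (1 - q)) ^ (2 * n) * (1 - α) * (1 - β) ∧ x = (α + β) / 2}
      (q ^ n / (q ^ n + (1 - q) ^ n)) := by
  have hb : 0 < (1 - q) ^ n := pow_pos (by linarith) n
  have hab : (1 - q) ^ n < q ^ n := pow_lt_pow_left₀ (by linarith) (by linarith) (by omega)
  rw [show (q / (1 - q)) ^ (2 * n) = (q ^ n) ^ 2 / ((1 - q) ^ n) ^ 2 by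
    rw [div_pow, ← pow_mul, ← pow_mul, mul_comm n 2]]
  generalize q ^ n = a at *
  generalize (1 - q) ^ n = b at *
  have ha : 0 < a := hb.trans hab
  constructor
  · refine ⟨a / (a + b), a / (a + b), by positivity, ?_, by positivity, ?_, ?_, by ring⟩
    · rw [div_le_one (by positivity)]; linarith
    · rw [div_le_one (by positivity)]; linarith
    · have h : 1 - a / (a + b) = b / (a + b) := by field_simp; ring
      rw [h]
      apply le_of_eq
      field_simp
  · rintro x ⟨α, β, hα, hα1, hβ, hβ1, h, rfl⟩
    have h' : b ^ 2 * (α * β) ≤ a ^ 2 * ((1 - α) * (1 - β)) := by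
      calc b ^ 2 * (α * β) ≤ b ^ 2 * (a ^ 2 / b ^ 2 * (1 - α) * (1 - β)) := by gcongr
        _ = a ^ 2 * ((1 - α) * (1 - β)) := by field_simp
    have hsq : (b * ((α + β) / 2)) ^ 2 ≤ (a * (1 - (α + β) / 2)) ^ 2 := by
      have hd : 0 ≤ (a ^ 2 - b ^ 2) * (α - β) ^ 2 :=
        mul_nonneg (by nlinarith) (sq_nonneg _)
      linarith
    have hle := le_of_abs_le (abs_le_of_sq_le_sq hsq (mul_nonneg ha.le (by linarith)))
    rw [le_div_iff₀ (by positivity)]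
    linarith
end

section
/- Let p ∈ (0,1) and let G be a real number with G > κ. Set s = √G, t = √((1−p)/p), and c = (s − t)/(s·t − 1). Then s·t > 1, c > 0, c·s/(1 + c·s) = α*(G), and s/(c + s) = β*(G). -/
open Real Filter

theorem stmt_17 (p G : ℝ) (hp0 : 0 < p) (hp1 : p < 1) (hG : G > kap p) :
    let s := Real.sqrt G
    let t := Real.sqrt ((1 - p) / p)
    let c := (s - t) / (s * t - 1)
    s * t > 1 ∧ c > 0 ∧ c * s / (1 + c * s) = astar p G ∧ s / (c + s) = bstar p G := by
  intro s t c
  have hq : 0 < 1 - p := by linarith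
  have h1 : p / (1 - p) < G := (le_max_left _ _).trans_lt hG
  have h2 : (1 - p) / p < G := (le_max_right _ _).trans_lt hG
  have hr : 0 < (1 - p) / p := by positivity
  have hG0 : 0 < G := hr.trans h2
  have hs : 0 < s := Real.sqrt_pos.2 hG0
  have ht : 0 < t := Real.sqrt_pos.2 hr
  have hss : s ^ 2 = G := Real.sq_sqrt hG0.le
  have hts : t < s := Real.sqrt_lt_sqrt hr.le h2
  have hst_eq : s * t = Real.sqrt ((1 - p) * G / p) := by
    rw [← Real.sqrt_mul hG0.le]
    congr 1
    ring
  have hdiv_eq : s / t = Real.sqrt (p * G / (1 - p)) := by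
    rw [← Real.sqrt_div hG0.le]
    congr 1
    field_simp
  have hst : 1 < s * t := by
    rw [hst_eq, Real.lt_sqrt zero_le_one, lt_div_iff₀ hp0]
    rw [div_lt_iff₀ hq] at h1
    linarith
  have hs1 : 0 < s ^ 2 - 1 := by nlinarith
  have hd : 0 < s * t - 1 := by linarith
  have hc : 0 < c := div_pos (by linarith) hd
  have hcd : c * (s * t - 1) = s - t := div_mul_cancel₀ _ hd.ne'
  refine ⟨hst, hc, ?_, ?_⟩
  · rw [astar, ← hst_eq, ← hss, div_eq_div_iff (by positivity) hs1.ne']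
    linear_combination s * hcd
  · rw [bstar, ← hdiv_eq, ← hss, div_eq_div_iff (by positivity) hs1.ne']
    field_simp
    linear_combination -hcd
end
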